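/- Let f_1, …, f_T : ℝ^d → ℝ be differentiable functions, each convex on K and α-smooth on K, and for each t let x_t⋆ ∈ K be a minimizer of f_t over K. Let x_1 ∈ K, and for each t = 1, …, T−1 let v_t ∈ K be a linear-optimization step at x_t for f_t, let σ_t ∈ [0,1] be a line-search step size at (x_t, v_t) for f_t, and set x_{t+1} = (1−σ_t)x_t + σ_t v_t (OFW with line search). Let M > 0 satisfy 2|f_t(u)| ≤ M for all t ∈ {1,…,T} and all u ∈ K. Let δ_2, …, δ_T be reals with |f_t(u) − f_{t−1}(u)| ≤ δ_t for all u ∈ K and all t = 2, …, T, and set V_T = Σ_{t=2}^T δ_t. Then Σ_{t=1}^T f_t(x_t) − Σ_{t=1}^T f_t(x_t⋆) ≤ √(M·T·(V_T + M)) + (αD²/2)·√((V_T + M)·T/M). -/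

import Mathlib

open RealInnerProductSpace Finset

/-- First-order lower bound for a convex function on a set, at a point of differentiability. -/
theorem ConvexOn.add_inner_gradient_le {E : Type*} [NormedAddCommGroup E]
    [InnerProductSpace ℝ E] [CompleteSpace E] {K : Set E} {f : E → ℝ} (hf : ConvexOn ℝ K f)
    {x u : E} (hx : x ∈ K) (hu : u ∈ K) (hd : DifferentiableAt ℝ f x) :
    f x + ⟪gradient f x, u - x⟫ ≤ f u := by
  have hconv := hf.comp_affineMap (AffineMap.lineMap x u : ℝ →ᵃ[ℝ] E)
  have hderiv : HasDerivAt (f ∘ (AffineMap.lineMap x u : ℝ →ᵃ[ℝ] E))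
      (fderiv ℝ f x (u - x)) 0 :=
    HasFDerivAt.comp_hasDerivAt_of_eq (0 : ℝ) hd.hasFDerivAt AffineMap.hasDerivAt_lineMap
      (by simp)
  have hslope := hconv.le_slope_of_hasDerivAt (x := 0) (y := 1)
    (by simpa using hx) (by simpa using hu) one_pos hderiv
  rw [inner_gradient_left, map_sub]
  simp only [slope_def_field, map_sub, Function.comp_apply, AffineMap.lineMap_apply_one,
    AffineMap.lineMap_apply_zero, sub_zero, div_one] at hslope
  linarith

/-- One Frank–Wolfe step with line search decreases the optimality gap at least as much as a step
of any other size `s ∈ [0, 1]`. -/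
theorem frankWolfe_lineSearch_step_le {E : Type*} [NormedAddCommGroup E]
    [InnerProductSpace ℝ E] [CompleteSpace E] {K : Set E} (hK : Convex ℝ K) {D α : ℝ}
    (hα : 0 ≤ α) {f : E → ℝ} (hf : ConvexOn ℝ K f) {x v u : E} (hx : x ∈ K) (hv : v ∈ K)
    (hu : u ∈ K) (hd : DifferentiableAt ℝ f x) (hdiam : ‖x - v‖ ≤ D)
    (hsmooth : ∀ y ∈ K, f y ≤ f x + ⟪gradient f x, y - x⟫ + α / 2 * ‖x - y‖ ^ 2)
    (hlin : ⟪gradient f x, v⟫ ≤ ⟪gradient f x, u⟫)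
    {r s : ℝ} (hr : r ∈ Set.Icc (0 : ℝ) 1) (hs : 0 ≤ s)
    (hls : r * ⟪gradient f x, v - x⟫ + α * r ^ 2 / 2 * ‖x - v‖ ^ 2 ≤
      s * ⟪gradient f x, v - x⟫ + α * s ^ 2 / 2 * ‖x - v‖ ^ 2) :
    f ((1 - r) • x + r • v) ≤ f x - s * (f x - f u) + α * s ^ 2 / 2 * D ^ 2 := by
  have hmem : (1 - r) • x + r • v ∈ K :=
    hK hx hv (sub_nonneg.2 hr.2) hr.1 (by ring)
  have hstep := hsmooth _ hmem
  have hfwd : (1 - r) • x + r • v - x = r • (v - x) := by module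
  have hbwd : x - ((1 - r) • x + r • v) = r • (x - v) := by module
  rw [hfwd, hbwd, inner_smul_right, norm_smul, mul_pow, Real.norm_eq_abs, sq_abs] at hstep
  have hgrad := hf.add_inner_gradient_le hx hu hd
  have hgap : ⟪gradient f x, v - x⟫ ≤ f u - f x := by
    rw [inner_sub_right] at hgrad ⊢
    linarith
  have hlin_part := mul_le_mul_of_nonneg_left hgap hs
  have hquad_part : α * s ^ 2 / 2 * ‖x - v‖ ^ 2 ≤ α * s ^ 2 / 2 * D ^ 2 := by gcongr
  linarith

/-- Optimizing `s * H ≤ S + T * (B * s ^ 2)` over `s ∈ [0, 1]`, given the trivial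
bound `H ≤ M * T`. -/
theorem le_sqrt_add_mul_sqrt_of_forall_mul_le {H S T B M : ℝ} (hM : 0 < M) (hT : 0 < T)
    (hS : 0 < S) (hB : 0 ≤ B) (htriv : H ≤ M * T)
    (h : ∀ s, 0 ≤ s → s ≤ 1 → s * H ≤ S + T * (B * s ^ 2)) :
    H ≤ √(M * T * S) + B * √(S * T / M) := by
  have hMT : 0 < M * T := mul_pos hM hT
  rcases le_total S (M * T) with hle | hge
  · set A := √(M * T * S) with hA
    have hApos : 0 < A := Real.sqrt_pos.2 (mul_pos hMT hS)
    have hAsq : A ^ 2 = M * T * S := Real.sq_sqrt (mul_pos hMT hS).le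
    have hsqrt : √(S * T / M) = A / M := by
      rw [Real.sqrt_eq_iff_mul_self_eq (by positivity) (by positivity)]
      field_simp
      linarith
    have hA_le : A ≤ M * T := Real.sqrt_le_iff.2 ⟨hMT.le, by nlinarith⟩
    have hs : 0 < A / (M * T) := div_pos hApos hMT
    have hmain := h (A / (M * T)) hs.le ((div_le_one hMT).2 hA_le)
    have hS_eq : S = A / (M * T) * A := by
      field_simp
      linarith
    have hquad_eq : T * (B * (A / (M * T)) ^ 2) = A / (M * T) * (B * (A / M)) := by
      field_simp
    rw [hsqrt]
    rw [hquad_eq] at hmain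
    exact le_of_mul_le_mul_left (by linarith) hs
  · have hroot : M * T ≤ √(M * T * S) := Real.le_sqrt_of_sq_le (by nlinarith)
    have : 0 ≤ B * √(S * T / M) := by positivity
    linarith

/-- Theorem 1: dynamic regret of OFW with line search for smooth functions. -/
theorem ofw_line_search_dynamic_regret
    {d T : ℕ} (hT : 1 ≤ T) {K : Set (EuclideanSpace ℝ (Fin d))}
    (hKne : K.Nonempty) (hKconv : Convex ℝ K)
    {D : ℝ} (hD : 0 < D) (hdiam : ∀ x ∈ K, ∀ y ∈ K, ‖x - y‖ ≤ D)
    {α : ℝ} (hα : 0 < α)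
    {f : ℕ → EuclideanSpace ℝ (Fin d) → ℝ}
    (hfdiff : ∀ t ∈ Finset.Icc 1 T, Differentiable ℝ (f t))
    (hfconv : ∀ t ∈ Finset.Icc 1 T, ConvexOn ℝ K (f t))
    (hfsmooth : ∀ t ∈ Finset.Icc 1 T, ∀ x ∈ K, ∀ y ∈ K,
      f t y ≤ f t x + ⟪gradient (f t) x, y - x⟫ + α / 2 * ‖x - y‖ ^ 2)
    {xstar : ℕ → EuclideanSpace ℝ (Fin d)}
    (hxstarK : ∀ t ∈ Finset.Icc 1 T, xstar t ∈ K)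
    (hxstar : ∀ t ∈ Finset.Icc 1 T, ∀ u ∈ K, f t (xstar t) ≤ f t u)
    {x v : ℕ → EuclideanSpace ℝ (Fin d)} (hx1 : x 1 ∈ K)
    (hvK : ∀ t ∈ Finset.Icc 1 (T - 1), v t ∈ K)
    (hv : ∀ t ∈ Finset.Icc 1 (T - 1), ∀ u ∈ K,
      ⟪gradient (f t) (x t), v t⟫ ≤ ⟪gradient (f t) (x t), u⟫)
    {σ : ℕ → ℝ} (hσ : ∀ t ∈ Finset.Icc 1 (T - 1), σ t ∈ Set.Icc (0 : ℝ) 1)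
    (hls : ∀ t ∈ Finset.Icc 1 (T - 1), ∀ σ' ∈ Set.Icc (0 : ℝ) 1,
      σ t * ⟪gradient (f t) (x t), v t - x t⟫
          + α * (σ t) ^ 2 / 2 * ‖x t - v t‖ ^ 2 ≤
        σ' * ⟪gradient (f t) (x t), v t - x t⟫
          + α * σ' ^ 2 / 2 * ‖x t - v t‖ ^ 2)
    (hupd : ∀ t ∈ Finset.Icc 1 (T - 1), x (t + 1) = (1 - σ t) • x t + σ t • v t)
    {M : ℝ} (hM : 0 < M) (hMbound : ∀ t ∈ Finset.Icc 1 T, ∀ u ∈ K, 2 * |f t u| ≤ M)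
    {δ : ℕ → ℝ}
    (hδ : ∀ t ∈ Finset.Icc 2 T, ∀ u ∈ K, |f t u - f (t - 1) u| ≤ δ t) :
    ∑ t ∈ Finset.Icc 1 T, f t (x t) - ∑ t ∈ Finset.Icc 1 T, f t (xstar t) ≤
      Real.sqrt (M * T * (∑ t ∈ Finset.Icc 2 T, δ t + M))
        + α * D ^ 2 / 2 * Real.sqrt ((∑ t ∈ Finset.Icc 2 T, δ t + M) * T / M) := by
  obtain ⟨n, rfl⟩ : ∃ n, T = n + 1 := ⟨T - 1, by omega⟩
  simp only [Nat.add_sub_cancel] at hvK hv hσ hls hupd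
  have hxK : ∀ t ∈ Finset.Icc 1 (n + 1), x t ∈ K := by
    intro t ht
    obtain ⟨h1, h2⟩ := Finset.mem_Icc.1 ht
    clear ht
    induction t, h1 using Nat.le_induction with
    | base => exact hx1
    | succ t h1 ih =>
      have ht : t ∈ Finset.Icc 1 n := Finset.mem_Icc.2 ⟨h1, by omega⟩
      rw [hupd t ht]
      exact hKconv (ih (by omega)) (hvK t ht) (sub_nonneg.2 (hσ t ht).2) (hσ t ht).1 (by ring)
  have hstep : ∀ s : ℝ, 0 ≤ s → s ≤ 1 → ∀ t ∈ Finset.Icc 1 n,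
      f t (x (t + 1)) ≤
        f t (x t) - s * (f t (x t) - f t (xstar t)) + α * s ^ 2 / 2 * D ^ 2 := by
    intro s hs0 hs1 t ht
    have ht' : t ∈ Finset.Icc 1 (n + 1) := Finset.Icc_subset_Icc_right (Nat.le_succ n) ht
    rw [hupd t ht]
    exact frankWolfe_lineSearch_step_le hKconv hα.le (hfconv t ht') (hxK t ht') (hvK t ht)
      (hxstarK t ht') (hfdiff t ht' _) (hdiam _ (hxK t ht') _ (hvK t ht))
      (hfsmooth t ht' _ (hxK t ht')) (hv t ht _ (hxstarK t ht')) (hσ t ht) hs0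
      (hls t ht s ⟨hs0, hs1⟩)
  have htelescope : ∀ s : ℝ, 0 ≤ s → s ≤ 1 → ∀ m ≤ n,
      f (m + 1) (x (m + 1)) + s * ∑ t ∈ Finset.Icc 1 m, (f t (x t) - f t (xstar t)) ≤
        f 1 (x 1) + ∑ t ∈ Finset.Icc 2 (m + 1), δ t + m * (α * s ^ 2 / 2 * D ^ 2) := by
    intro s hs0 hs1 m hm
    induction m with
    | zero => simp
    | succ m ih =>
      have hdec := hstep s hs0 hs1 (m + 1) (Finset.mem_Icc.2 ⟨by omega, hm⟩)
      have hvar := (abs_le.1 (hδ (m + 1 + 1) (Finset.mem_Icc.2 ⟨by omega, by omega⟩) _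
        (hxK (m + 1 + 1) (Finset.mem_Icc.2 ⟨by omega, by omega⟩)))).2
      rw [Nat.add_sub_cancel] at hvar
      rw [Finset.sum_Icc_succ_top (by omega), Finset.sum_Icc_succ_top (by omega)]
      push_cast
      linarith [ih (by omega)]
  have hgap_le : ∀ t ∈ Finset.Icc 1 (n + 1), f t (x t) - f t (xstar t) ≤ M := by
    intro t ht
    linarith [le_abs_self (f t (x t)), neg_le_abs (f t (xstar t)),
      hMbound t ht _ (hxK t ht), hMbound t ht _ (hxstarK t ht)]
  have hlast : n + 1 ∈ Finset.Icc 1 (n + 1) := Finset.mem_Icc.2 ⟨hT, le_rfl⟩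
  have hfirst : 1 ∈ Finset.Icc 1 (n + 1) := Finset.mem_Icc.2 ⟨le_rfl, hT⟩
  have hV : 0 ≤ ∑ t ∈ Finset.Icc 2 (n + 1), δ t :=
    Finset.sum_nonneg fun t ht => (abs_nonneg _).trans (hδ t ht _ hx1)
  rw [← Finset.sum_sub_distrib]
  have hbound := le_sqrt_add_mul_sqrt_of_forall_mul_le
    (H := ∑ t ∈ Finset.Icc 1 (n + 1), (f t (x t) - f t (xstar t)))
    (S := ∑ t ∈ Finset.Icc 2 (n + 1), δ t + M) (T := ((n + 1 : ℕ) : ℝ))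
    (B := α * D ^ 2 / 2) hM (by positivity) (by linarith) (by positivity)
  refine hbound ?_ ?_
  · refine (Finset.sum_le_card_nsmul _ _ M hgap_le).trans_eq ?_
    simp [mul_comm]
  · intro s hs0 hs1
    have hsum := htelescope s hs0 hs1 n le_rfl
    have hgap_last : s * (f (n + 1) (x (n + 1)) - f (n + 1) (xstar (n + 1))) ≤
        f (n + 1) (x (n + 1)) - f (n + 1) (xstar (n + 1)) :=
      mul_le_of_le_one_left (sub_nonneg.2 (hxstar _ hlast _ (hxK _ hlast))) hs1
    have hquad : 0 ≤ α * s ^ 2 / 2 * D ^ 2 := by positivity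
    rw [Finset.sum_Icc_succ_top (by omega)]
    push_cast
    linarith [le_abs_self (f 1 (x 1)), neg_le_abs (f (n + 1) (xstar (n + 1))),
      hMbound 1 hfirst _ hx1, hMbound _ hlast _ (hxstarK _ hlast)]
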